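/- Every circular-arc model of a normal Helly circular-arc (NHCA) graph that is not an interval graph is itself an NHCA model; that is, if G is an NHCA graph admitting no interval model, then every circular-arc model whose intersection graph is isomorphic to G is both normal and Helly. -/

import Mathlib

open Set

noncomputable section

instance : Fact ((0:ℝ) < 1) := ⟨one_pos⟩

/-- A point on the circle (of circumference 1). -/
abbrev Circ : Type := AddCircle (1 : ℝ)

/-- An arc of the circle, described by its beginning point `s` and its ending point `t`
(the arc is traversed clockwise, i.e. in the positive circular direction, from `s` to `t`). -/
structure Arc where
  s : Circ
  t : Circ

/-- The set of points of the open arc: the points strictly between `s` and `t`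
in the circular order. -/
def Arc.pts (A : Arc) : Set Circ := {x | sbtw A.s x A.t}

/-- The length of an arc: the representative in `(0, 1]` of `t - s`. -/
def Arc.length (A : Arc) : ℝ := ((AddCircle.equivIoc (1:ℝ) 0) (A.t - A.s) : ℝ)

/-- A circular-arc (CA) model: a finite family of arcs of the circle such that all
endpoints of the arcs are pairwise distinct (in particular each arc has two distinct
endpoints, hence no arc covers the whole circle). -/
structure CAModel (V : Type) [Fintype V] where
  arc : V → Arc
  endpoints_distinct : Function.Injective
    (fun p : V × Bool => if p.2 then (arc p.1).s else (arc p.1).t)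

namespace CAModel

variable {V : Type} [Fintype V]

/-- The arcs of `u` and `v` intersect. -/
def Inter (M : CAModel V) (u v : V) : Prop := ((M.arc u).pts ∩ (M.arc v).pts).Nonempty

/-- The intersection graph of the model: two distinct arcs are adjacent iff they have
nonempty intersection. -/
def interGraph (M : CAModel V) : SimpleGraph V :=
  SimpleGraph.fromRel fun u v => M.Inter u v

/-- `M` is a model of the graph `G`: the arcs are in correspondence with the vertices of `G`
and two vertices are adjacent iff their arcs are distinct and intersect. -/
def IsModelOf (M : CAModel V) (G : SimpleGraph V) : Prop :=
  ∀ u v, G.Adj u v ↔ u ≠ v ∧ M.Inter u v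

/-- Helly model: every subfamily of pairwise intersecting arcs has a common point. -/
def Helly (M : CAModel V) : Prop :=
  ∀ S : Set V, (∀ u ∈ S, ∀ v ∈ S, M.Inter u v) → ∃ p : Circ, ∀ v ∈ S, p ∈ (M.arc v).pts

/-- Normal model: no two arcs together cover the whole circle. -/
def Normal (M : CAModel V) : Prop :=
  ∀ u v : V, u ≠ v → (M.arc u).pts ∪ (M.arc v).pts ≠ Set.univ

/-- No three arcs together cover the whole circle. -/
def NoThreeCover (M : CAModel V) : Prop :=
  ∀ u v w : V, u ≠ v → u ≠ w → v ≠ w →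
    (M.arc u).pts ∪ (M.arc v).pts ∪ (M.arc w).pts ≠ Set.univ

/-- Proper model: no arc is properly contained in another arc. -/
def Proper (M : CAModel V) : Prop :=
  ∀ u v : V, u ≠ v → ¬ (M.arc u).pts ⊂ (M.arc v).pts

/-- Unit model: all arcs have the same length. -/
def IsUnit (M : CAModel V) : Prop :=
  ∀ u v : V, (M.arc u).length = (M.arc v).length

/-- Interval model: some point of the circle is covered by no arc. -/
def IsIntervalModel (M : CAModel V) : Prop :=
  ∃ p : Circ, ∀ v : V, p ∉ (M.arc v).pts

/-- A universal arc: it intersects every other arc of the model. -/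
def UniversalArc (M : CAModel V) (v : V) : Prop :=
  ∀ w, w ≠ v → M.Inter v w

end CAModel

section GraphClasses

variable {V : Type} [Fintype V]

def IsCAGraph (G : SimpleGraph V) : Prop := ∃ M : CAModel V, M.IsModelOf G
def IsHCAGraph (G : SimpleGraph V) : Prop := ∃ M : CAModel V, M.Helly ∧ M.IsModelOf G
def IsNCAGraph (G : SimpleGraph V) : Prop := ∃ M : CAModel V, M.Normal ∧ M.IsModelOf G
def IsNHCAGraph (G : SimpleGraph V) : Prop :=
  ∃ M : CAModel V, M.Normal ∧ M.Helly ∧ M.IsModelOf G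
def IsPCAGraph (G : SimpleGraph V) : Prop := ∃ M : CAModel V, M.Proper ∧ M.IsModelOf G
def IsNPCAGraph (G : SimpleGraph V) : Prop :=
  ∃ M : CAModel V, M.Normal ∧ M.Proper ∧ M.IsModelOf G
def IsPHCAGraph (G : SimpleGraph V) : Prop :=
  ∃ M : CAModel V, M.Proper ∧ M.Helly ∧ M.IsModelOf G
def IsUCAGraph (G : SimpleGraph V) : Prop := ∃ M : CAModel V, M.IsUnit ∧ M.IsModelOf G
def IsUHCAGraph (G : SimpleGraph V) : Prop :=
  ∃ M : CAModel V, M.IsUnit ∧ M.Helly ∧ M.IsModelOf G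
def IsIntervalGraph (G : SimpleGraph V) : Prop :=
  ∃ M : CAModel V, M.IsIntervalModel ∧ M.IsModelOf G

end GraphClasses
/-! ### Some small graphs -/

/-- The claw `K_{1,3}`: vertex `0` is adjacent to `1`, `2`, `3`, which are pairwise
non-adjacent. -/
def claw : SimpleGraph (Fin 4) := SimpleGraph.fromRel fun u _ => u = 0

/-- The `n`-wheel `W_n`: a chordless cycle on `n` vertices plus one extra vertex adjacent
to all of them (intended for `n ≥ 4`). -/
def wheel (n : ℕ) : SimpleGraph (Fin n ⊕ Unit) :=
  SimpleGraph.fromRel fun u v =>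
    (∃ x, u = Sum.inr x) ∨
    (∃ i j : Fin n, u = Sum.inl i ∧ v = Sum.inl j ∧ ((i : ℕ) + 1) % n = (j : ℕ))

/-- The 3-sun `S_3`: vertices `0,1,2` (the `v_i`'s) are pairwise adjacent, vertices
`3,4,5` (the `w_i`'s) are pairwise non-adjacent, and `w_i` is adjacent exactly to
`v_i` and `v_{i+1 (mod 3)}`. -/
def sun3 : SimpleGraph (Fin 6) :=
  SimpleGraph.fromRel fun u v =>
    ((u : ℕ) < 3 ∧ (v : ℕ) < 3) ∨
    (3 ≤ (u : ℕ) ∧ ((v : ℕ) = (u : ℕ) - 3 ∨ (v : ℕ) = ((u : ℕ) - 2) % 3))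

/-- The tent: the complement of the 3-sun. -/
def tent : SimpleGraph (Fin 6) := sun3ᶜ

/-- The `n`-rising sun `R_n` (intended for `n ≥ 4`): vertices `inl 0, …, inl (n-1)`
are `v_1, …, v_n` where `v_2, …, v_{n-1}` form a path in this order and `v_1`, `v_n`
are adjacent to all the `v`'s; `inr 0 = w_1` is adjacent exactly to `v_1, v_2`;
`inr 1 = w_{n-1}` is adjacent exactly to `v_{n-1}, v_n`; and `inr 2 = w_n` is adjacent
exactly to `v_n, v_1`. -/
def risingSun (n : ℕ) : SimpleGraph (Fin n ⊕ Fin 3) :=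
  SimpleGraph.fromRel fun u v =>
    match u, v with
    | Sum.inl a, Sum.inl b => (a : ℕ) = 0 ∨ (a : ℕ) = n - 1 ∨ (b : ℕ) = (a : ℕ) + 1
    | Sum.inr w, Sum.inl a =>
        ((w : ℕ) = 0 ∧ ((a : ℕ) = 0 ∨ (a : ℕ) = 1)) ∨
        ((w : ℕ) = 1 ∧ ((a : ℕ) = n - 2 ∨ (a : ℕ) = n - 1)) ∨
        ((w : ℕ) = 2 ∧ ((a : ℕ) = n - 1 ∨ (a : ℕ) = 0))
    | _, _ => False

/-- The umbrella: a path `0,1,2,3,4`, a vertex `5` adjacent to all of `0,…,4`, and a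
vertex `6` adjacent only to `2`. -/
def umbrella : SimpleGraph (Fin 7) :=
  SimpleGraph.fromRel fun u v =>
    ((u : ℕ) < 5 ∧ (v : ℕ) = (u : ℕ) + 1 ∧ (v : ℕ) < 5) ∨
    ((u : ℕ) = 5 ∧ (v : ℕ) < 5) ∨
    ((u : ℕ) = 6 ∧ (v : ℕ) = 2)

/-- Strict betweenness in the circular order induced by a linear order. -/
def InR (s x t : ℝ) : Prop := (s < x ∧ x < t) ∨ (x < t ∧ t < s) ∨ (t < s ∧ s < x)

/-- Cutting the circle at a point `p`. -/
theorem exists_cut (p : Circ) : ∃ f : Circ → ℝ, f p = 0 ∧ (∀ x, 0 ≤ f x ∧ f x < 1) ∧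
    (∀ r, 0 ≤ r → r < 1 → ∃ x, f x = r) ∧ Function.Injective f ∧
    ∀ a b c, sbtw a b c ↔ InR (f a) (f b) (f c) := by
  let e := AddCircle.equivIco (1:ℝ) 0
  let f : Circ → ℝ := fun x => (e (x - p) : ℝ)
  have hf : ∀ x, 0 ≤ f x ∧ f x < 1 := by
    intro x
    have := (e (x - p)).2
    simpa using this
  have hfx : ∀ x, x = p + ((f x : ℝ) : Circ) := by
    intro x
    have : ((f x : ℝ) : Circ) = x - p := (AddCircle.equivIco (1:ℝ) 0).symm_apply_apply (x - p)
    rw [this]; abel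
  have hinj : Function.Injective f := by
    intro x y h
    rw [hfx x, hfx y, h]
  have hsurj : ∀ r : ℝ, 0 ≤ r → r < 1 → f (p + (r : Circ)) = r := by
    intro r h0 h1
    have h2 : (p + (r : Circ)) - p = (r : Circ) := by abel
    change ((e ((p + (r : Circ)) - p) : Ico (0:ℝ) (0+1)) : ℝ) = r
    rw [h2]
    have := (AddCircle.equivIco (1:ℝ) 0).apply_symm_apply ⟨r, by simp [h0, h1]⟩
    exact congrArg Subtype.val this
  refine ⟨f, ?_, hf, fun r h0 h1 => ⟨_, hsurj r h0 h1⟩, hinj, ?_⟩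
  · have := hsurj 0 le_rfl one_pos
    simpa using this
  · have hico : ∀ a b, toIcoMod (one_pos : (0:ℝ) < 1) 0 (f b - f a) =
        if f a ≤ f b then f b - f a else f b - f a + 1 := by
      intro a b
      have ha := hf a
      have hb := hf b
      split_ifs with h
      · rw [toIcoMod_eq_self]
        constructor <;> linarith
      · rw [← toIcoMod_add_right, toIcoMod_eq_self]
        constructor <;> linarith
    have hioc : ∀ a b, toIocMod (one_pos : (0:ℝ) < 1) 0 (f b - f a) =
        if f a < f b then f b - f a else f b - f a + 1 := by
      intro a b
      have ha := hf a
      have hb := hf b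
      split_ifs with h
      · rw [toIocMod_eq_self]
        constructor <;> linarith
      · rw [← toIocMod_add_right, toIocMod_eq_self]
        constructor <;> linarith
    have hbtw : ∀ a b c : Circ, btw a b c ↔
        toIcoMod (one_pos : (0:ℝ) < 1) 0 (f b - f a) ≤ toIocMod (one_pos : (0:ℝ) < 1) 0 (f c - f a) := by
      intro a b c
      obtain ⟨q, rfl⟩ := QuotientAddGroup.mk_surjective p
      rw [hfx a, hfx b, hfx c]
      have := QuotientAddGroup.btw_coe_iff' (p := (1:ℝ)) (x₁ := q + f a) (x₂ := q + f b) (x₃ := q + f c)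
      simp only [add_sub_add_left_eq_sub] at this
      rw [← hfx a, ← hfx b, ← hfx c]
      rw [← this]
      conv_lhs => rw [hfx a, hfx b, hfx c]
      rfl
    intro a b c
    rw [sbtw_iff_not_btw, hbtw, hico, hioc, InR]
    have ha := hf a
    have hb := hf b
    have hc := hf c
    split_ifs <;> grind

namespace CAModel

variable {V : Type} [Fintype V]

theorem s_ne_t (M : CAModel V) (u v : V) : (M.arc u).s ≠ (M.arc v).t := by
  intro h
  have := @M.endpoints_distinct (u, true) (v, false) (by simpa using h)
  simp at this

theorem s_inj (M : CAModel V) {u v : V} (h : (M.arc u).s = (M.arc v).s) : u = v := by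
  have := @M.endpoints_distinct (u, true) (v, true) (by simpa using h)
  simpa using this

theorem Inter.symm' {M : CAModel V} {u v : V} (h : M.Inter u v) : M.Inter v u := by
  unfold Inter at *
  rwa [inter_comm]

theorem inter_self' (M : CAModel V) (u : V) : M.Inter u u := by
  obtain ⟨f, f0, hf, hs, hi, hb⟩ := exists_cut (M.arc u).s
  have hne : f (M.arc u).t ≠ 0 := by
    rw [← f0]
    exact fun h => M.s_ne_t u u (hi h).symm
  have h1 := hf (M.arc u).t
  have h2 : 0 < f (M.arc u).t := lt_of_le_of_ne h1.1 hne.symm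
  obtain ⟨x, hx⟩ := hs (f (M.arc u).t / 2) (by linarith) (by linarith)
  have : x ∈ (M.arc u).pts := by
    change sbtw (M.arc u).s x (M.arc u).t
    rw [hb, InR, f0, hx]
    left; constructor <;> linarith
  exact ⟨x, this, this⟩

theorem Normal.exists_not {M : CAModel V} (h : M.Normal) (u v : V) :
    ∃ z, z ∉ (M.arc u).pts ∧ z ∉ (M.arc v).pts := by
  by_cases huv : u = v
  · subst huv
    refine ⟨(M.arc u).s, ?_, ?_⟩ <;> exact fun h => sbtw_irrefl_left (a := (M.arc u).s) (b := (M.arc u).t) h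
  · have := h u v huv
    rw [Ne, eq_univ_iff_forall] at this
    push Not at this
    simpa using this

/-- Helly, for three arcs. -/
theorem Helly.three {M : CAModel V} (h : M.Helly) {u v w : V} (huv : M.Inter u v)
    (huw : M.Inter u w) (hvw : M.Inter v w) :
    ∃ p, p ∈ (M.arc u).pts ∧ p ∈ (M.arc v).pts ∧ p ∈ (M.arc w).pts := by
  obtain ⟨p, hp⟩ := h {u, v, w} (by
    have := M.inter_self'
    have := huv.symm'
    have := huw.symm'
    have := hvw.symm'
    simp only [mem_insert_iff, mem_singleton_iff]
    rintro a (rfl | rfl | rfl) b (rfl | rfl | rfl) <;> first | assumption | exact M.inter_self' _)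
  exact ⟨p, hp u (by simp), hp v (by simp), hp w (by simp)⟩

/-- Three pairwise intersecting arcs of an NHCA model, with extremal endpoints. -/
theorem nhca_three {M : CAModel V} (hN : M.Normal) (hH : M.Helly) {u v w : V} (huv : M.Inter u v)
    (huw : M.Inter u w) (hvw : M.Inter v w) :
    ∃ f : Circ → ℝ, (∀ x, 0 ≤ f x ∧ f x < 1) ∧
    (∀ r, 0 ≤ r → r < 1 → ∃ x, f x = r) ∧ Function.Injective f ∧
    (∀ a b c, sbtw a b c ↔ InR (f a) (f b) (f c)) ∧
    ∃ a ∈ ({u, v, w} : Set V), ∃ b ∈ ({u, v, w} : Set V),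
      f (M.arc a).t ≤ f (M.arc b).s ∧
      ∀ c ∈ ({u, v, w} : Set V), 0 < f (M.arc c).t ∧ f (M.arc c).t < f (M.arc c).s ∧
        f (M.arc c).t ≤ f (M.arc a).t ∧ f (M.arc b).s ≤ f (M.arc c).s := by
  obtain ⟨p, hp⟩ := hH.three huv huw hvw
  obtain ⟨f, f0, hf, hs, hi, hb⟩ := exists_cut p
  refine ⟨f, hf, hs, hi, hb, ?_⟩
  have hfin : ({u, v, w} : Set V).Finite := by simp
  obtain ⟨a, ha, ha'⟩ := Set.exists_max_image _ (fun c => f (M.arc c).t) hfin ⟨u, by simp⟩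
  obtain ⟨b, hb1, hb'⟩ := Set.exists_min_image _ (fun c => f (M.arc c).s) hfin ⟨u, by simp⟩
  have key : ∀ c ∈ ({u, v, w} : Set V), 0 < f (M.arc c).t ∧ f (M.arc c).t < f (M.arc c).s := by
    intro c hc
    have hpc : p ∈ (M.arc c).pts := by
      rcases hc with rfl | rfl | rfl
      exacts [hp.1, hp.2.1, hp.2.2]
    have := (hb _ _ _).1 hpc
    rw [f0, InR] at this
    have h1 := hf (M.arc c).s
    have h2 := hf (M.arc c).t
    grind
  refine ⟨a, ha, b, hb1, ?_, fun c hc => ⟨(key c hc).1, (key c hc).2, ha' c hc, hb' c hc⟩⟩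
  obtain ⟨z, hz1, hz2⟩ := hN.exists_not a b
  have h1 : ¬ InR _ _ _ := fun h => hz1 ((hb _ _ _).2 h)
  have h2 : ¬ InR _ _ _ := fun h => hz2 ((hb _ _ _).2 h)
  have ka := key a ha
  have kb := key b hb1
  unfold InR at h1 h2
  grind

theorem nhca_no_three {M : CAModel V} (hN : M.Normal) (hH : M.Helly) {u v w : V}
    (huv : M.Inter u v) (huw : M.Inter u w) (hvw : M.Inter v w) :
    ∃ z, z ∉ (M.arc u).pts ∧ z ∉ (M.arc v).pts ∧ z ∉ (M.arc w).pts := by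
  obtain ⟨f, hf, hs, hi, hb, a, ha, b, hb1, hab, hc⟩ := nhca_three hN hH huv huw hvw
  have hz : ∀ c ∈ ({u, v, w} : Set V), (M.arc a).t ∉ (M.arc c).pts := by
    intro c hcm h
    have := (hb _ _ _).1 h
    have := hc c hcm
    unfold InR at *
    grind
  exact ⟨_, hz u (by simp), hz v (by simp), hz w (by simp)⟩

/-- Main argument on the NHCA model. -/
theorem nhca_main {M : CAModel V} (hN : M.Normal) (hH : M.Helly)
    (hcov : ∀ p, ∃ v, p ∈ (M.arc v).pts) {u v w : V}
    (huv : M.Inter u v) (huw : M.Inter u w) (hvw : M.Inter v w)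
    (hdom : ∀ x y, M.Inter x y → ∃ a ∈ ({u, v, w} : Set V), M.Inter a x ∧ M.Inter a y) : False := by
  obtain ⟨f, hf, hs, hi, hb, a, ha, b, hb1, hTS, hc⟩ := nhca_three hN hH huv huw hvw
  have hmem : ∀ c z, z ∈ (M.arc c).pts ↔ InR (f (M.arc c).s) (f z) (f (M.arc c).t) :=
    fun c z => hb _ _ _
  have hka := hc a ha
  have hkb := hc b hb1
  have hab : M.Inter a b := by
    obtain ⟨z, hz⟩ := hs 0 le_rfl one_pos
    refine ⟨z, ?_, ?_⟩ <;> rw [hmem, hz, InR] <;> grind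
  have hst : ∀ c, f (M.arc c).s ≠ f (M.arc c).t := fun c h => M.s_ne_t c c (hi h)
  have N2 : ∀ x y, ∃ z, 0 ≤ z ∧ z < 1 ∧ ¬ InR (f (M.arc x).s) z (f (M.arc x).t) ∧
      ¬ InR (f (M.arc y).s) z (f (M.arc y).t) := by
    intro x y
    obtain ⟨z, h1, h2⟩ := hN.exists_not x y
    exact ⟨f z, (hf z).1, (hf z).2, by rwa [← hmem], by rwa [← hmem]⟩
  have N3 : ∀ x, M.Inter x a → M.Inter x b → ∃ z, 0 ≤ z ∧ z < 1 ∧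
      ¬ InR (f (M.arc x).s) z (f (M.arc x).t) ∧
      ¬ InR (f (M.arc a).s) z (f (M.arc a).t) ∧ ¬ InR (f (M.arc b).s) z (f (M.arc b).t) := by
    intro x h1 h2
    obtain ⟨z, h1, h2, h3⟩ := nhca_no_three hN hH h1 h2 hab
    exact ⟨f z, (hf z).1, (hf z).2, by rwa [← hmem], by rwa [← hmem], by rwa [← hmem]⟩
  have inter_of : ∀ x y r, 0 ≤ r → r < 1 → InR (f (M.arc x).s) r (f (M.arc x).t) →
      InR (f (M.arc y).s) r (f (M.arc y).t) → M.Inter x y := by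
    intro x y r h0 h1 hx hy
    obtain ⟨z, rfl⟩ := hs r h0 h1
    exact ⟨z, (hmem _ _).2 hx, (hmem _ _).2 hy⟩
  have D : ∀ x y, M.Inter x y → ∃ z, InR (f (M.arc x).s) z (f (M.arc x).t) ∧
      InR (f (M.arc y).s) z (f (M.arc y).t) ∧ (z < f (M.arc a).t ∨ f (M.arc b).s < z) := by
    intro x y hxy
    obtain ⟨c, hcm, hcx, hcy⟩ := hdom x y hxy
    obtain ⟨z, h1, h2, h3⟩ := hH.three hcx hcy hxy
    refine ⟨f z, (hmem _ _).1 h2, (hmem _ _).1 h3, ?_⟩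
    have h1' := (hmem _ _).1 h1
    have := hc c hcm
    unfold InR at h1'
    grind
  set T := f (M.arc a).t with hT
  set S := f (M.arc b).s with hS
  have bS := hf (M.arc b).s
  have bounds : ∀ x, InR (f (M.arc x).s) T (f (M.arc x).t) → T < f (M.arc x).t ∧ f (M.arc x).t ≤ S := by
    intro x hx
    have bs := hf (M.arc x).s
    have bt := hf (M.arc x).t
    obtain ⟨z1, z10, z11, z12, z13⟩ := N2 x a
    obtain ⟨z2, z20, z21, z22, z23⟩ := N2 x b
    have h1 : T < f (M.arc x).t := by
      unfold InR at *
      grind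
    refine ⟨h1, ?_⟩
    by_contra hlt
    push Not at hlt
    rcases lt_or_ge (f (M.arc x).t) (f (M.arc x).s) with h | h
    · unfold InR at *
      grind
    · have hsT : f (M.arc x).s < T := by
        unfold InR at hx
        grind
      obtain ⟨z, z0, z1, z2, z3, z4⟩ := N3 x
        (inter_of x a ((f (M.arc x).s + T) / 2) (by linarith) (by linarith)
          (Or.inl ⟨by linarith, by linarith⟩) (Or.inr (Or.inl ⟨by linarith, by linarith⟩)))
        (inter_of x b ((f (M.arc x).t + S) / 2) (by linarith) (by linarith)
          (Or.inl ⟨by linarith, by linarith⟩) (Or.inr (Or.inr ⟨by linarith, by linarith⟩)))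
      clear D N3 N2 inter_of
      unfold InR at z2 z3 z4
      grind
  obtain ⟨x, hx, hxmax⟩ := Set.exists_max_image {x | InR (f (M.arc x).s) T (f (M.arc x).t)}
    (fun x => f (M.arc x).t) (Set.toFinite _) (by
      obtain ⟨x, hx⟩ := hcov (M.arc a).t
      exact ⟨x, (hmem _ _).1 hx⟩)
  simp only [mem_ofPred_eq] at hx hxmax
  obtain ⟨hx1, hx2⟩ := bounds x hx
  obtain ⟨y, hy⟩ := hcov (M.arc x).t
  rw [hmem] at hy
  have bxs := hf (M.arc x).s
  have bxt := hf (M.arc x).t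
  have bys := hf (M.arc y).s
  have byt := hf (M.arc y).t
  have by1 := bounds y
  have by2 := hxmax y
  obtain ⟨z1, z10, z11, z12, z13⟩ := N2 x y
  obtain ⟨z2, z20, z21, z22, z23⟩ := N2 y a
  have hstx := hst x
  have hsty := hst y
  have hint : f (M.arc y).s < f (M.arc x).t ∧ T ≤ f (M.arc y).s := by
    clear D N3 N2 inter_of
    unfold InR at *
    grind
  have hxy : M.Inter x y := by
    refine inter_of x y ((f (M.arc y).s + f (M.arc x).t) / 2) (by linarith) (by linarith) ?_ ?_
    · have h1 : f (M.arc y).s < (f (M.arc y).s + f (M.arc x).t) / 2 := by linarith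
      have h2 : (f (M.arc y).s + f (M.arc x).t) / 2 < f (M.arc x).t := by linarith
      generalize (f (M.arc y).s + f (M.arc x).t) / 2 = r at *
      clear D N3 N2 inter_of
      unfold InR at hx ⊢
      grind
    · have h1 : f (M.arc y).s < (f (M.arc y).s + f (M.arc x).t) / 2 := by linarith
      have h2 : (f (M.arc y).s + f (M.arc x).t) / 2 < f (M.arc x).t := by linarith
      generalize (f (M.arc y).s + f (M.arc x).t) / 2 = r at *
      clear D N3 N2 inter_of
      unfold InR at hy ⊢
      grind
  obtain ⟨z, hz1, hz2, hz3⟩ := D x y hxy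
  clear D N3 N2 inter_of
  unfold InR at *
  grind

/-- A model that is not NHCA has a covering clique of size at most three. -/
theorem normal_helly_of_no_cover (M : CAModel V)
    (h : ∀ u v w, M.Inter u v → M.Inter u w → M.Inter v w →
      ∃ z, z ∉ (M.arc u).pts ∧ z ∉ (M.arc v).pts ∧ z ∉ (M.arc w).pts) : M.Normal ∧ M.Helly := by
  constructor
  · intro u v huv hcov
    rw [eq_univ_iff_forall] at hcov
    have hsv : (M.arc u).s ∈ (M.arc v).pts :=
      (hcov (M.arc u).s).resolve_left (fun h => sbtw_irrefl_left (a := (M.arc u).s) (b := (M.arc u).t) h)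
    have hint : M.Inter u v := by
      obtain ⟨f, f0, hf, hs, hi, hb⟩ := exists_cut (M.arc u).s
      have hne : f (M.arc u).t ≠ 0 := by
        rw [← f0]
        exact fun h => M.s_ne_t u u (hi h).symm
      have hsv' := (hb _ _ _).1 hsv
      rw [f0] at hsv'
      have b1 := hf (M.arc u).t
      have b2 := hf (M.arc v).t
      have b3 := hf (M.arc v).s
      have h2 : 0 < f (M.arc u).t := lt_of_le_of_ne b1.1 hne.symm
      have h3 : 0 < f (M.arc v).t ∧ f (M.arc v).t < f (M.arc v).s := by
        unfold InR at hsv'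
        grind
      obtain ⟨r, hr0, hr⟩ := exists_between (lt_min h2 h3.1)
      rw [lt_min_iff] at hr
      obtain ⟨z, rfl⟩ := hs r hr0.le (by linarith)
      refine ⟨z, (hb _ _ _).2 (Or.inl ?_), (hb _ _ _).2 (Or.inr (Or.inl ⟨hr.2, h3.2⟩))⟩
      rw [f0]
      exact ⟨hr0, hr.1⟩
    obtain ⟨z, h1, h2, -⟩ := h u v v hint hint (M.inter_self' v)
    rcases hcov z with h | h
    exacts [h1 h, h2 h]
  · intro X hX
    rcases X.eq_empty_or_nonempty with rfl | ⟨A, hA⟩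
    · exact ⟨0, by simp⟩
    obtain ⟨f, f0, hf, hs, hi, hb⟩ := exists_cut (M.arc A).s
    have hmem : ∀ c z, z ∈ (M.arc c).pts ↔ InR (f (M.arc c).s) (f z) (f (M.arc c).t) :=
      fun c z => hb _ _ _
    have ht0 : ∀ c, 0 < f (M.arc c).t := by
      intro c
      refine lt_of_le_of_ne (hf _).1 ?_
      rw [← f0]
      exact fun h => M.s_ne_t A c (hi h)
    have hst : ∀ c, f (M.arc c).s ≠ f (M.arc c).t := fun c h => M.s_ne_t c c (hi h)
    have N3 : ∀ B ∈ X, ∀ C ∈ X, ∃ z, 0 ≤ z ∧ z < 1 ∧ ¬ InR (f (M.arc A).s) z (f (M.arc A).t) ∧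
        ¬ InR (f (M.arc B).s) z (f (M.arc B).t) ∧ ¬ InR (f (M.arc C).s) z (f (M.arc C).t) := by
      intro B hB C hC
      obtain ⟨z, h1, h2, h3⟩ := h A B C (hX A hA B hB) (hX A hA C hC) (hX B hB C hC)
      exact ⟨f z, (hf z).1, (hf z).2, by rwa [← hmem], by rwa [← hmem], by rwa [← hmem]⟩
    have I : ∀ B ∈ X, ∀ C ∈ X, ∃ z, 0 ≤ z ∧ z < 1 ∧ InR (f (M.arc B).s) z (f (M.arc B).t) ∧
        InR (f (M.arc C).s) z (f (M.arc C).t) := by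
      intro B hB C hC
      obtain ⟨z, h1, h2⟩ := hX B hB C hC
      exact ⟨f z, (hf z).1, (hf z).2, by rwa [← hmem], by rwa [← hmem]⟩
    rw [f0] at N3
    let l : V → ℝ := fun B => if f (M.arc B).s < f (M.arc B).t then f (M.arc B).s else 0
    have hl0 : ∀ B, 0 ≤ l B := by
      intro B
      simp only [l]
      split_ifs
      exacts [(hf _).1, le_rfl]
    have hA0 := ht0 A
    have hA1 := (hf (M.arc A).t).2
    have hin : ∀ B ∈ X, ∀ r, 0 < r → r < f (M.arc A).t →
        (InR (f (M.arc B).s) r (f (M.arc B).t) ↔ l B < r ∧ r < f (M.arc B).t) := by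
      intro B hB r hr0 hr1
      obtain ⟨z, z0, z1, z2, z3, -⟩ := N3 B hB B hB
      have hsB := hf (M.arc B).s
      have htB := ht0 B
      have := hst B
      simp only [l]
      clear I N3 hl0 l
      unfold InR at *
      split_ifs <;> grind
    have hlt : ∀ B ∈ X, ∀ C ∈ X, l B < f (M.arc C).t := by
      intro B hB C hC
      obtain ⟨z, z0, z1, z2, z3, z4⟩ := N3 B hB C hC
      obtain ⟨y, y0, y1, y2, y3⟩ := I B hB C hC
      obtain ⟨y', y0', y1', y2', y3'⟩ := I A hA B hB
      obtain ⟨y'', y0'', y1'', y2'', y3''⟩ := I A hA C hC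
      rw [f0] at y2' y2''
      have hsB := hf (M.arc B).s
      have htB := ht0 B
      have htC := ht0 C
      have hsC := hf (M.arc C).s
      have h1 := hst B
      have h2 := hst C
      by_contra hcon
      push Not at hcon
      have hsB : f (M.arc B).s < f (M.arc B).t ∧ f (M.arc C).t ≤ f (M.arc B).s := by
        simp only [l] at hcon
        split_ifs at hcon <;> grind
      clear I N3 hl0 hin hcon l
      have e1 : f (M.arc B).s < f (M.arc A).t := by
        unfold InR at y2' y3'
        grind
      have e2 : f (M.arc C).s < y ∧ f (M.arc A).t ≤ y := by
        clear z2 z3 z4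
        unfold InR at *
        grind
      unfold InR at *
      grind
    obtain ⟨B, hB, hBmax⟩ := Set.exists_max_image X l (Set.toFinite _) ⟨A, hA⟩
    obtain ⟨C, hC, hCmin⟩ := Set.exists_min_image X (fun c => f (M.arc c).t) (Set.toFinite _) ⟨A, hA⟩
    obtain ⟨r, hr1, hr2⟩ := exists_between (hlt B hB C hC)
    have hr0 : 0 < r := lt_of_le_of_lt (hl0 B) hr1
    have hrA : r < f (M.arc A).t := lt_of_lt_of_le hr2 (hCmin A hA)
    obtain ⟨p, rfl⟩ := hs r hr0.le (hrA.trans hA1)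
    refine ⟨p, fun D hD => ?_⟩
    rw [hmem, hin D hD _ hr0 hrA]
    exact ⟨lt_of_le_of_lt (hBmax D hD) hr1, lt_of_lt_of_le hr2 (hCmin D hD)⟩

end CAModel

/-- Every circular-arc model of an NHCA graph that is not an interval
graph is itself an NHCA model. -/
theorem stmt_6 {V : Type} [Fintype V] (G : SimpleGraph V)
    (hG : IsNHCAGraph G) (hni : ¬ IsIntervalGraph G)
    {W : Type} [Fintype W] (M : CAModel W)
    (hM : Nonempty (M.interGraph ≃g G)) :
    M.Normal ∧ M.Helly := by
  obtain ⟨M0, hN, hH, hmod⟩ := hG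
  obtain ⟨φ⟩ := hM
  have hcov : ∀ p, ∃ v, p ∈ (M0.arc v).pts := by
    by_contra hcon
    push Not at hcon
    exact hni ⟨M0, hcon, hmod⟩
  have htr : ∀ a b, M.Inter a b ↔ M0.Inter (φ a) (φ b) := by
    intro a b
    by_cases hab : a = b
    · subst hab
      exact ⟨fun _ => M0.inter_self' _, fun _ => M.inter_self' _⟩
    · have h1 : G.Adj (φ a) (φ b) ↔ M.interGraph.Adj a b := φ.map_adj_iff
      have h0 : M.interGraph.Adj a b ↔ a ≠ b ∧ (M.Inter a b ∨ M.Inter b a) :=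
        SimpleGraph.fromRel_adj _ a b
      rw [hmod, h0] at h1
      have h2 : φ a ≠ φ b := fun h => hab (φ.injective h)
      constructor
      · intro h
        exact (h1.2 ⟨hab, Or.inl h⟩).2
      · intro h
        rcases (h1.1 ⟨h2, h⟩).2 with h | h
        exacts [h, h.symm']
  apply M.normal_helly_of_no_cover
  intro u v w huv huw hvw
  by_contra hcon
  push Not at hcon
  refine CAModel.nhca_main hN hH hcov ((htr _ _).1 huv) ((htr _ _).1 huw) ((htr _ _).1 hvw) ?_
  intro x y hxy
  obtain ⟨x, rfl⟩ := φ.surjective x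
  obtain ⟨y, rfl⟩ := φ.surjective y
  obtain ⟨z, hzx, hzy⟩ := (htr _ _).2 hxy
  by_cases h1 : z ∈ (M.arc u).pts
  · exact ⟨φ u, by simp, (htr _ _).1 ⟨z, h1, hzx⟩, (htr _ _).1 ⟨z, h1, hzy⟩⟩
  by_cases h2 : z ∈ (M.arc v).pts
  · exact ⟨φ v, by simp, (htr _ _).1 ⟨z, h2, hzx⟩, (htr _ _).1 ⟨z, h2, hzy⟩⟩
  have h3 := hcon z h1 h2
  exact ⟨φ w, by simp, (htr _ _).1 ⟨z, h3, hzx⟩, (htr _ _).1 ⟨z, h3, hzy⟩⟩
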